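/- For the sets J and K associated with d = 3 and v = (1,−1,−1), with T_n = X_n + X_nY_n + Y_n and R_n = U_n + U_nV_n + V_n, the following congruences hold modulo 2 for every n ≥ 1: Z_{3n} ≡ W_nR_n; W_{3n} ≡ Z_nT_n; Z_{3n+1} ≡ W_{n+1}R_n; W_{3n+1} ≡ Z_{n+1}T_n; Z_{3n+2} ≡ W_{n+1}; W_{3n+2} ≡ Z_{n+1}; T_{3n} ≡ R_n; R_{3n} ≡ T_n; T_{3n+1} ≡ W_{n+1}R_n; R_{3n+1} ≡ Z_{n+1}T_n; T_{3n+2} ≡ W_{n+1}R_{n+1}; R_{3n+2} ≡ Z_{n+1}T_{n+1}. -/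

import Mathlib

/-- `J` for `d = 3`, `v = (1,−1,−1)`:
`{(3n+1)·3^{2k} − 1} ∪ {(3n+2)·3^{2k+1} − 1}`. -/
def J3 : Set ℕ :=
  {t | ∃ n k : ℕ, t + 1 = (3 * n + 1) * 3 ^ (2 * k)} ∪
  {t | ∃ n k : ℕ, t + 1 = (3 * n + 2) * 3 ^ (2 * k + 1)}

/-- `K` for `d = 3`, `v = (1,−1,−1)`:
`{(3n+2)·3^{2k} − 1} ∪ {(3n+1)·3^{2k+1} − 1}`. -/
def K3 : Set ℕ :=
  {t | ∃ n k : ℕ, t + 1 = (3 * n + 2) * 3 ^ (2 * k)} ∪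
  {t | ∃ n k : ℕ, t + 1 = (3 * n + 1) * 3 ^ (2 * k + 1)}

/-- The number of permutations `σ` of `{0,…,m−1}` with `i + σ(i) ∈ S` for all
`i ≠ l`. -/
noncomputable def permCount (S : Set ℕ) (m l : ℕ) : ℕ :=
  Nat.card {σ : Equiv.Perm (Fin m) //
    ∀ i : Fin m, (i : ℕ) ≠ l → ((i : ℕ) + ((σ i : Fin m) : ℕ)) ∈ S}

noncomputable def X (n : ℕ) : ℕ := ∑ i ∈ Finset.range n, permCount J3 n i
noncomputable def Y (n : ℕ) : ℕ := permCount J3 n n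
noncomputable def Z (n : ℕ) : ℕ := permCount J3 n (n - 1)
noncomputable def U (n : ℕ) : ℕ := ∑ i ∈ Finset.range n, permCount K3 n i
noncomputable def V (n : ℕ) : ℕ := permCount K3 n n
noncomputable def W (n : ℕ) : ℕ := permCount K3 n (n - 1)


noncomputable def T (n : ℕ) : ℕ := X n + X n * Y n + Y n
noncomputable def R (n : ℕ) : ℕ := U n + U n * V n + V n

open Matrix
open scoped Polynomial

/-- An identity between functions of a square matrix that commute with algebra homomorphisms holds
for every matrix as soon as it holds for the matrices with invertible determinant. -/
theorem eq_of_forall_isUnit_det {K : Type} [Field K] {n : Type*} [Fintype n] [DecidableEq n]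
    (f g : ∀ (R : Type) [CommRing R] [Algebra K R], Matrix n n R → R)
    (hf : ∀ (R S : Type) [CommRing R] [CommRing S] [Algebra K R] [Algebra K S] (φ : R →ₐ[K] S)
      (M : Matrix n n R), f S (M.map φ) = φ (f R M))
    (hg : ∀ (R S : Type) [CommRing R] [CommRing S] [Algebra K R] [Algebra K S] (φ : R →ₐ[K] S)
      (M : Matrix n n R), g S (M.map φ) = φ (g R M))
    (h : ∀ (R : Type) [CommRing R] [Algebra K R] (M : Matrix n n R), IsUnit M.det → f R M = g R M)
    (P : Matrix n n K) : f K P = g K P := by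
  have key : f K[X] (charmatrix (-P)) = g K[X] (charmatrix (-P)) := by
    let φ : K[X] →ₐ[K] FractionRing K[X] := IsScalarTower.toAlgHom K K[X] (FractionRing K[X])
    have hφ : Function.Injective φ := IsFractionRing.injective K[X] (FractionRing K[X])
    apply hφ
    rw [← hf, ← hg]
    apply h
    have : ((charmatrix (-P)).map φ).det = φ (charmatrix (-P)).det := (AlgHom.map_det φ _).symm
    rw [this, isUnit_iff_ne_zero, map_ne_zero_iff _ hφ]
    exact (charpoly_monic (-P)).ne_zero
  have hP : (charmatrix (-P)).map (Polynomial.aeval (R := K) (0 : K)) = P := by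
    ext i j
    by_cases hij : i = j
    · subst hij; simp
    · simp [hij]
  rw [← hP, hf, hg, key]

/-- The Desnanot–Jacobi identity. -/
theorem det_submatrix_inl_mul_det {K : Type} [Field K] {m : Type*} [Fintype m] [DecidableEq m]
    (M : Matrix (m ⊕ Fin 2) (m ⊕ Fin 2) K) :
    (M.submatrix Sum.inl Sum.inl).det * M.det =
      (M.submatrix (Sum.map id fun _ : Unit => 0) (Sum.map id fun _ : Unit => 0)).det *
        (M.submatrix (Sum.map id fun _ : Unit => 1) (Sum.map id fun _ : Unit => 1)).det -
      (M.submatrix (Sum.map id fun _ : Unit => 0) (Sum.map id fun _ : Unit => 1)).det *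
        (M.submatrix (Sum.map id fun _ : Unit => 1) (Sum.map id fun _ : Unit => 0)).det := by
  let N (R : Type) [CommRing R] [Algebra K R] (P : Matrix m m R) :
      Matrix (m ⊕ Fin 2) (m ⊕ Fin 2) R :=
    fromBlocks P (M.toBlocks₁₂.map (algebraMap K R)) (M.toBlocks₂₁.map (algebraMap K R))
      (M.toBlocks₂₂.map (algebraMap K R))
  let d (R : Type) [CommRing R] [Algebra K R] (P : Matrix m m R) (i j : Fin 2) : R :=
    ((N R P).submatrix (Sum.map id fun _ : Unit => i) (Sum.map id fun _ : Unit => j)).det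
  have hN (R S : Type) [CommRing R] [CommRing S] [Algebra K R] [Algebra K S] (φ : R →ₐ[K] S)
      (P : Matrix m m R) : N S (P.map φ) = (N R P).map φ := by
    ext (i | i) (j | j) <;> simp [N]
  have hd (R S : Type) [CommRing R] [CommRing S] [Algebra K R] [Algebra K S] (φ : R →ₐ[K] S)
      (P : Matrix m m R) (i j : Fin 2) : d S (P.map φ) i j = φ (d R P i j) := by
    simp only [d, hN, AlgHom.map_det]
    rfl
  have key := eq_of_forall_isUnit_det (K := K) (n := m) (fun R _ _ P => P.det * (N R P).det)
    (fun R _ _ P => d R P 0 0 * d R P 1 1 - d R P 0 1 * d R P 1 0)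
    (fun R S _ _ _ _ φ P => by
      simp only [hN, map_mul, AlgHom.map_det, AlgHom.mapMatrix_apply])
    (fun R S _ _ _ _ φ P => by simp only [hd, map_mul, map_sub])
    (fun R _ _ P hP => by
      have : Invertible P := invertibleOfIsUnitDet P hP
      have hd' (i j : Fin 2) : d R P i j = P.det * (M.toBlocks₂₂.map (algebraMap K R) -
          M.toBlocks₂₁.map (algebraMap K R) * ⅟P * M.toBlocks₁₂.map (algebraMap K R)) i j := by
        have : (N R P).submatrix (Sum.map id fun _ : Unit => i) (Sum.map id fun _ : Unit => j) =
            fromBlocks P ((M.toBlocks₁₂.map (algebraMap K R)).submatrix id fun _ : Unit => j)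
              ((M.toBlocks₂₁.map (algebraMap K R)).submatrix (fun _ : Unit => i) id)
              ((M.toBlocks₂₂.map (algebraMap K R)).submatrix
                (fun _ : Unit => i) (fun _ : Unit => j)) := by
          ext (i | i) (j | j) <;> simp [N]
        simp only [d, this, det_fromBlocks₁₁, det_unique]
        rfl
      simp only [hd', N, det_fromBlocks₁₁, det_fin_two]
      ring)
    M.toBlocks₁₁
  have hM : N K M.toBlocks₁₁ = M := by
    ext (i | i) (j | j) <;> rfl
  simp only [d, hM] at key
  exact key

theorem det_add_one_of_isUnit_det {R : Type*} [CommRing R] {n : Type*} [Fintype n]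
    [DecidableEq n] {P : Matrix n n R} (hP : IsUnit P.det) :
    (P + of fun _ _ => 1).det = P.det + P.det * ∑ i, (P⁻¹ *ᵥ 1) i := by
  have h : (of fun _ _ => 1 : Matrix n n R) =
      replicateCol Unit (1 : n → R) * replicateRow Unit (1 : n → R) := by
    ext i j; simp [mul_apply]
  rw [h, det_add_replicateCol_mul_replicateRow hP, det_unique (n := Unit), Matrix.add_apply,
    one_apply_eq, mul_add, mul_one, Matrix.mul_assoc]
  congr 2
  simp [mul_apply, mulVec, dotProduct]

/-- The matrix determinant lemma for the all-ones matrix, without an invertibility assumption. -/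
theorem det_add_one_eq_add_sum {K : Type} [Field K] {n : Type*} [Fintype n] [DecidableEq n]
    (B : Matrix n n K) :
    (B + of fun _ _ => 1).det = B.det + ∑ i, (B.updateRow i 1).det := by
  have key := eq_of_forall_isUnit_det (K := K) (n := n)
    (fun R _ _ P => (P + of fun _ _ => 1).det)
    (fun R _ _ P => P.det + ∑ i, (P.updateRow i 1).det)
    (fun R S _ _ _ _ φ P => by
      rw [AlgHom.map_det]
      congr 1
      ext i j
      simp)
    (fun R S _ _ _ _ φ P => by
      simp only [map_add, map_sum, AlgHom.map_det, AlgHom.mapMatrix_apply, Matrix.map_updateRow]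
      congr! 4
      simp [Function.comp_def]
      rfl)
    (fun R _ _ P hP => by
      have h (i : n) : (P.updateRow i 1).det = ∑ j, P.adjugate j i := by
        rw [← cramer_transpose_apply, cramer_eq_adjugate_mulVec, ← adjugate_transpose]
        simp [mulVec, dotProduct]
      have hadj (i j : n) : P.adjugate i j = P.det * P⁻¹ i j := by
        rw [inv_def, Matrix.smul_apply, smul_eq_mul, ← mul_assoc, Ring.mul_inverse_cancel _ hP, one_mul]
      simp only [det_add_one_of_isUnit_det hP, h, hadj, mulVec, dotProduct, Pi.one_apply, mul_one,
        Finset.mul_sum]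
      rw [Finset.sum_comm])
    B
  exact key

open scoped Kronecker in
/-- Determinant of a block matrix whose blocks differ from a block-scalar matrix by multiples of
the all-ones matrix. -/
theorem det_one_kronecker_add_kronecker_one {K : Type} [Field K] {k n : Type*} [Fintype k]
    [DecidableEq k] [Fintype n] [DecidableEq n] (C : Matrix k k K) (B : Matrix n n K) :
    ((1 : Matrix k k K) ⊗ₖ B + C ⊗ₖ (of fun _ _ => 1 : Matrix n n K)).det =
      (B.det • (1 : Matrix k k K) + ((B + of fun _ _ => 1).det - B.det) • C).det := by
  have key := eq_of_forall_isUnit_det (K := K) (n := n)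
    (fun R _ _ P => ((1 : Matrix k k R) ⊗ₖ P +
      C.map (algebraMap K R) ⊗ₖ (of fun _ _ => 1 : Matrix n n R)).det)
    (fun R _ _ P => (P.det • (1 : Matrix k k R) +
      ((P + of fun _ _ => 1).det - P.det) • C.map (algebraMap K R)).det)
    (fun R S _ _ _ _ φ P => by
      rw [AlgHom.map_det]
      congr 1
      ext ⟨i, i'⟩ ⟨j, j'⟩
      simp [one_apply, apply_ite φ])
    (fun R S _ _ _ _ φ P => by
      have h1 : (P.map φ).det = φ P.det := (AlgHom.map_det φ P).symm
      have h2 : (P.map φ + of fun _ _ => 1).det = φ (P + of fun _ _ => 1).det := by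
        rw [AlgHom.map_det]
        congr 1
        ext i j
        simp
      rw [AlgHom.map_det, h1, h2]
      congr 1
      ext i j
      simp [one_apply, apply_ite φ])
    (fun R _ _ P hP => by
      let w : n → R := P⁻¹ *ᵥ 1
      let t : R := ∑ i, w i
      have hw (i : n) : ∑ j, P i j * w j = 1 := by
        have : P *ᵥ w = 1 := by simp [w, mulVec_mulVec, mul_nonsing_inv P hP]
        exact congrFun this i
      let Ur (C : Matrix k k R) : Matrix (k × n) k R := of fun p q => C p.1 q * w p.2
      let Vr : Matrix k (k × n) R := of fun q p => (1 : Matrix k k R) q p.1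
      have hUV (C : Matrix k k R) : (1 : Matrix k k R) ⊗ₖ P + C ⊗ₖ (of fun _ _ => 1) =
          ((1 : Matrix k k R) ⊗ₖ P) * (1 + Ur C * Vr) := by
        rw [mul_add, mul_one]
        congr 1
        ext ⟨i, i'⟩ ⟨j, j'⟩
        have h : ∑ x, P i' x * (C i j * w x) = C i j := by
          simp_rw [mul_left_comm _ (C i j)]
          rw [← Finset.mul_sum, hw, mul_one]
        simp [mul_apply, Ur, Vr, Fintype.sum_prod_type, one_apply, h]
      have hVU (C : Matrix k k R) : Vr * Ur C = t • C := by
        ext i j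
        simp [mul_apply, Ur, Vr, Fintype.sum_prod_type, one_apply, t, Finset.mul_sum,
          mul_comm]
      have hdt : (P + of fun _ _ => 1).det - P.det = P.det * t := by
        rw [det_add_one_of_isUnit_det hP, add_sub_cancel_left]
      rw [hUV, det_mul, det_one_add_mul_comm, hVU, det_kronecker, hdt, det_one, mul_smul,
        ← smul_add, det_smul]
      simp)
    B
  simpa using key

theorem ZMod.intCast_units_two (u : ℤˣ) : ((u : ℤ) : ZMod 2) = 1 := by
  rcases Int.units_eq_one_or u with rfl | rfl <;> decide

/-- Permuting rows and columns independently does not change a determinant modulo 2. -/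
theorem det_submatrix_of_bijective {ι κ : Type*} [Fintype ι] [DecidableEq ι] [Fintype κ]
    [DecidableEq κ] {f g : ι → κ} (hf : f.Bijective) (hg : g.Bijective)
    (M : Matrix κ κ (ZMod 2)) : (M.submatrix f g).det = M.det := by
  let e := Equiv.ofBijective f hf
  let σ : Equiv.Perm κ := e.symm.trans (Equiv.ofBijective g hg)
  have h : M.submatrix f g = (M.submatrix id σ).submatrix e e := by
    ext i j
    simp [σ, e]
  rw [h, det_submatrix_equiv_self, det_permute', ZMod.intCast_units_two, one_mul]

/-- The `n × n` Hankel matrix of a sequence. -/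
def hankel (a : ℕ → ZMod 2) (n : ℕ) : Matrix (Fin n) (Fin n) (ZMod 2) := of fun i j => a (i + j)

/-- The Hankel matrix of size `n + 1` with its last row replaced by ones. -/
def hankelLastOne (a : ℕ → ZMod 2) (n : ℕ) : Matrix (Fin (n + 1)) (Fin (n + 1)) (ZMod 2) :=
  (hankel a (n + 1)).updateRow (Fin.last n) 1

theorem hankel_add_one (a : ℕ → ZMod 2) (n : ℕ) :
    hankel (a + 1) n = hankel a n + of fun _ _ => 1 := rfl

theorem det_of_add_eq_det_hankel {ι : Type*} [Fintype ι] [DecidableEq ι] {N : ℕ} {f g : ι → ℕ}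
    (a : ℕ → ZMod 2) (hf : f.Injective) (hfN : ∀ i, f i < N) (hg : g.Injective)
    (hgN : ∀ i, g i < N) (hN : Fintype.card ι = N) :
    (of fun i j => a (f i + g j)).det = (hankel a N).det := by
  refine det_submatrix_of_bijective (f := fun i => ⟨f i, hfN i⟩) (g := fun i => ⟨g i, hgN i⟩)
    ?_ ?_ (hankel a N) <;>
  refine (Fintype.bijective_iff_injective_and_card _).2
    ⟨fun i j h => ?_, hN.trans (Fintype.card_fin N).symm⟩
  · exact hf (congrArg Fin.val h)
  · exact hg (congrArg Fin.val h)

theorem bijective_castSucc_elim_last (n : ℕ) :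
    (Sum.elim Fin.castSucc fun _ : Unit => Fin.last n).Bijective := by
  refine (Fintype.bijective_iff_injective_and_card _).2 ⟨?_, by simp⟩
  refine (Fin.castSucc_injective n).sumElim (Function.injective_of_subsingleton _) ?_
  exact fun i _ => (Fin.castSucc_lt_last i).ne

theorem det_hankelLastOne_eq_det_fromBlocks (a : ℕ → ZMod 2) (n : ℕ) :
    (hankelLastOne a n).det = (fromBlocks (hankel a n) (of fun i (_ : Unit) => a (i + n))
      (of fun (_ : Unit) _ => 1) 1).det := by
  rw [← det_submatrix_of_bijective (bijective_castSucc_elim_last n)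
    (bijective_castSucc_elim_last n)]
  congr 1
  ext (i | i) (j | j) <;>
    simp [hankelLastOne, hankel, updateRow_apply, (Fin.castSucc_lt_last _).ne]

theorem det_hankelLastOne (a : ℕ → ZMod 2) (n : ℕ) :
    (hankelLastOne a n).det = (of fun i j : Fin n => a (i + j) + a (i + n)).det := by
  rw [det_hankelLastOne_eq_det_fromBlocks, det_fromBlocks_one₂₂]
  congr 1
  ext i j
  simp [hankel, mul_apply, CharTwo.sub_eq_add]

theorem det_hankelLastOne_add_one (a : ℕ → ZMod 2) (n : ℕ) :
    (hankelLastOne (a + 1) n).det = (hankelLastOne a n).det := by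
  simp only [det_hankelLastOne, Pi.add_apply, Pi.one_apply]
  congr! 4
  ring_nf
  simp [CharTwo.two_eq_zero]

theorem ZMod.mul_self_two (x : ZMod 2) : x * x = x := by
  revert x; decide

theorem det_hankelLastOne_eq_cross (a : ℕ → ZMod 2) (n : ℕ) :
    (hankelLastOne a n).det =
      (hankel a (n + 1)).det * (hankel (a + 1) n).det +
        (hankel a n).det * (hankel (a + 1) (n + 1)).det := by
  have hbord (k : ℕ) : (hankel (a + 1) k).det = (fromBlocks (hankel a k)
      (of fun _ (_ : Unit) => 1) (of fun (_ : Unit) _ => 1) 1).det := by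
    rw [det_fromBlocks_one₂₂]
    congr 1
    ext i j
    simp [hankel, mul_apply, CharTwo.sub_eq_add]
  let M : Matrix (Fin n ⊕ Fin 2) (Fin n ⊕ Fin 2) (ZMod 2) :=
    fromBlocks (hankel a n) (of fun i k => ![a (i + n), 1] k) (of fun k j => ![a (n + j), 1] k)
      !![a (n + n), 1; 1, 1]
  have h := det_submatrix_inl_mul_det M
  have hM : M.det = (hankel (a + 1) (n + 1)).det := by
    have hb : (Sum.elim (fun i : Fin n => Sum.inl i.castSucc)
        ![Sum.inl (Fin.last n), Sum.inr ()] : _ → Fin (n + 1) ⊕ Unit).Bijective := by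
      refine (Fintype.bijective_iff_injective_and_card _).2 ⟨?_, by simp⟩
      rintro (i | i) (j | j) h
      · simpa using h
      · fin_cases j <;> simp [(Fin.castSucc_lt_last _).ne] at h
      · fin_cases i <;> simp [(Fin.castSucc_lt_last _).ne'] at h
      · fin_cases i <;> fin_cases j <;> simp at h ⊢
    rw [hbord, ← det_submatrix_of_bijective hb hb]
    congr 1
    ext (i | i) (j | j)
    · simp [M, hankel]
    · fin_cases j <;> simp [M, hankel]
    · fin_cases i <;> simp [M, hankel]
    · fin_cases i <;> fin_cases j <;> simp [M, hankel]
  have h00 : (M.submatrix (Sum.map id fun _ : Unit => 0) (Sum.map id fun _ : Unit => 0)).det =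
      (hankel a (n + 1)).det := by
    rw [← det_submatrix_of_bijective (bijective_castSucc_elim_last n)
      (bijective_castSucc_elim_last n)]
    congr 1
    ext (i | i) (j | j) <;> simp [M, hankel]
  have h11 : (M.submatrix (Sum.map id fun _ : Unit => 1) (Sum.map id fun _ : Unit => 1)).det =
      (hankel (a + 1) n).det := by
    rw [hbord]
    congr 1
    ext (i | i) (j | j) <;> simp [M]
  have h10 : (M.submatrix (Sum.map id fun _ : Unit => 1) (Sum.map id fun _ : Unit => 0)).det =
      (hankelLastOne a n).det := by
    rw [det_hankelLastOne_eq_det_fromBlocks]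
    congr 1
    ext (i | i) (j | j) <;> simp [M]
  have h01 : (M.submatrix (Sum.map id fun _ : Unit => 0) (Sum.map id fun _ : Unit => 1)).det =
      (hankelLastOne a n).det := by
    rw [det_hankelLastOne_eq_det_fromBlocks, ← det_transpose]
    congr 1
    ext (i | i) (j | j) <;> simp [M, hankel, add_comm]
  have hP : (M.submatrix Sum.inl Sum.inl).det = (hankel a n).det := rfl
  rw [hM, h00, h11, h10, h01, hP, ZMod.mul_self_two] at h
  rw [h, CharTwo.sub_eq_add, ← add_assoc, CharTwo.add_self_eq_zero, zero_add]

/-- The determinant of a Hankel matrix of size `3n + 1` or `3n + 2` when two of the three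
trisections of the sequence are constant. -/
theorem det_hankel_of_trisection {b b' : ℕ → ZMod 2} {c₀ c₁ : ZMod 2} (h0 : ∀ t, b (3 * t) = c₀)
    (h1 : ∀ t, b (3 * t + 1) = c₁) (h2 : ∀ t, b (3 * t + 2) = b' t) {n m : ℕ} (hnm : n ≤ m)
    (hmn : m ≤ n + 1) :
    (hankel b (2 * n + m + 1)).det = (hankelLastOne b' n).det *
      (fromBlocks (of fun _ _ => c₀) (of fun _ _ => c₁) (of fun _ _ => c₁) (hankel b' m) :
        Matrix (Unit ⊕ Fin m) (Unit ⊕ Fin m) (ZMod 2)).det := by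
  have e00 (x y : ℕ) : b (3 * x + 3 * y) = c₀ := by rw [← h0 (x + y)]; congr 1; ring
  have e01 (x y : ℕ) : b (3 * x + (3 * y + 1)) = c₁ := by rw [← h1 (x + y)]; congr 1; ring
  have e10 (x y : ℕ) : b (3 * x + 1 + 3 * y) = c₁ := by rw [← h1 (x + y)]; congr 1; ring
  have e11 (x y : ℕ) : b (3 * x + 1 + (3 * y + 1)) = b' (x + y) := by
    rw [← h2 (x + y)]; congr 1; ring
  have e02 (x y : ℕ) : b (3 * x + (3 * y + 2)) = b' (y + x) := by
    rw [← h2 (y + x)]; congr 1; ring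
  have e20 (x y : ℕ) : b (3 * x + 2 + 3 * y) = b' (x + y) := by
    rw [← h2 (x + y)]; congr 1; ring
  let κ := Unit ⊕ Fin m
  let mid : κ → ℕ := Sum.elim (fun _ => 3 * n) (fun i => 3 * i + 1)
  let rf : (Fin n ⊕ κ) ⊕ Fin n → ℕ :=
    Sum.elim (Sum.elim (fun i => 3 * i) mid) (fun i => 3 * i + 2)
  let cf : (Fin n ⊕ κ) ⊕ Fin n → ℕ :=
    Sum.elim (Sum.elim (fun i => 3 * i + 2) mid) (fun i => 3 * i)
  have hrf : rf.Injective := by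
    rintro ((i | i | i) | i) ((j | j | j) | j) h <;>
      simp only [rf, mid, Sum.elim_inl, Sum.elim_inr] at h <;>
      first | omega | (congr <;> omega)
  have hcf : cf.Injective := by
    rintro ((i | i | i) | i) ((j | j | j) | j) h <;>
      simp only [cf, mid, Sum.elim_inl, Sum.elim_inr] at h <;>
      first | omega | (congr <;> omega)
  have hrN (i) : rf i < 2 * n + m + 1 := by
    rcases i with (i | i | i) | i <;> simp only [rf, mid, Sum.elim_inl, Sum.elim_inr] <;> omega
  have hcN (i) : cf i < 2 * n + m + 1 := by
    rcases i with (i | i | i) | i <;> simp only [cf, mid, Sum.elim_inl, Sum.elim_inr] <;> omega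
  rw [← det_of_add_eq_det_hankel b hrf hrN hcf hcN (by simp [κ]; ring)]
  let k : (Fin n ⊕ κ) ⊕ Fin n := .inl (.inr (.inl ()))
  let M₀ : Matrix ((Fin n ⊕ κ) ⊕ Fin n) ((Fin n ⊕ κ) ⊕ Fin n) (ZMod 2) :=
    of fun i j => b (rf i + cf j)
  let u : (Fin n ⊕ κ) ⊕ Fin n → ZMod 2 := Sum.elim (Sum.elim 1 0) 0
  let v : (Fin n ⊕ κ) ⊕ Fin n → ZMod 2 := Sum.elim 0 1
  let M₁ : Matrix ((Fin n ⊕ κ) ⊕ Fin n) ((Fin n ⊕ κ) ⊕ Fin n) (ZMod 2) :=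
    of fun i j => M₀ i j - u i * M₀ k j
  let M₂ : Matrix ((Fin n ⊕ κ) ⊕ Fin n) ((Fin n ⊕ κ) ⊕ Fin n) (ZMod 2) :=
    of fun i j => M₁ i j - v j * M₁ i k
  have h01 : M₀.det = M₁.det :=
    det_eq_of_forall_row_eq_smul_add_const u k rfl fun i j => by simp [M₁, u, k]
  have h12 : M₁.det = M₂.det := by
    rw [← det_transpose, ← det_transpose M₂]
    exact det_eq_of_forall_row_eq_smul_add_const v k rfl fun i j => by simp [M₂, v, k]
  let G : Matrix (Fin n) (Fin n) (ZMod 2) := of fun i j => b' (i + j) + b' (i + n)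
  have hG : (hankelLastOne b' n).det = G.det := det_hankelLastOne b' n
  have hM : M₂ = fromBlocks (fromBlocks Gᵀ 0 M₂.toBlocks₁₁.toBlocks₂₁ (fromBlocks (of fun _ _ => c₀)
      (of fun _ _ => c₁) (of fun _ _ => c₁) (hankel b' m))) 0 M₂.toBlocks₂₁ G := by
    ext ((i | i | i) | i) ((j | j | j) | j) <;>
      simp [M₂, M₁, M₀, G, u, v, k, rf, cf, mid, hankel, toBlocks₁₁, toBlocks₂₁, e00, e01, e10, e11,
        e02, e20, CharTwo.sub_eq_add, CharTwo.add_self_eq_zero]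
  change M₀.det = _
  rw [h01, h12, hM, det_fromBlocks_zero₁₂, det_fromBlocks_zero₁₂, det_transpose, hG,
    mul_right_comm, ZMod.mul_self_two]

theorem det_fromBlocks_one_zero (a : ℕ → ZMod 2) (m : ℕ) :
    (fromBlocks (of fun _ _ => 1) (of fun _ _ => 0) (of fun _ _ => 0) (hankel a m) :
      Matrix (Unit ⊕ Fin m) (Unit ⊕ Fin m) (ZMod 2)).det = (hankel a m).det :=
  (det_fromBlocks_zero₂₁ _ _ _).trans (by simp)

theorem det_fromBlocks_zero_one (a : ℕ → ZMod 2) (m : ℕ) :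
    (fromBlocks (of fun _ _ => 0) (of fun _ _ => 1) (of fun _ _ => 1) (hankel a m) :
      Matrix (Unit ⊕ Fin m) (Unit ⊕ Fin m) (ZMod 2)).det =
      (hankel a m).det + (hankel (a + 1) m).det := by
  let P (x y : ZMod 2) : Matrix (Unit ⊕ Fin m) (Unit ⊕ Fin m) (ZMod 2) :=
    fromBlocks (of fun _ _ => x) (of fun _ _ => y) (of fun _ _ => 1) (hankel a m)
  have h (x y : ZMod 2) : P x y =
      (P 0 1).updateRow (.inl ()) (Sum.elim (fun _ => x) fun _ => y) := by
    ext (i | i) (j | j) <;> simp [P, updateRow_apply]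
  have h10 : (P 1 0).det = (hankel a m).det := by
    refine (det_fromBlocks_zero₁₂ _ (of fun _ _ => 1) (hankel a m)).trans (by simp)
  have h11 : (P 1 1).det = (hankel (a + 1) m).det := by
    have : (of fun _ _ => 1 : Matrix Unit Unit (ZMod 2)) = 1 := by ext; simp
    simp only [P]
    rw [this, det_fromBlocks_one₁₁]
    congr 1
    ext i j
    simp [hankel, mul_apply, CharTwo.sub_eq_add]
  change (P 0 1).det = _
  rw [← h10, ← h11, h 1 0, h 1 1, ← det_updateRow_add]
  conv_lhs => rw [h 0 1]
  congr 2
  ext (i | i)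
  · simp [CharTwo.add_self_eq_zero]
  · simp

theorem add_one_add_one (a : ℕ → ZMod 2) : a + 1 + 1 = a := by
  rw [add_assoc, CharTwo.add_self_eq_zero, add_zero]

/-- The Hankel determinant of size `3n` when two of the three trisections of the sequence are
constant. -/
theorem det_hankel_three_mul_of_trisection {b b' : ℕ → ZMod 2} {c₀ c₁ : ZMod 2}
    (h0 : ∀ t, b (3 * t) = c₀) (h1 : ∀ t, b (3 * t + 1) = c₁) (h2 : ∀ t, b (3 * t + 2) = b' t)
    (n : ℕ) :
    (hankel b (3 * n)).det =
      ((hankel b' n).det • (1 : Matrix (Fin 3) (Fin 3) (ZMod 2)) +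
        ((hankel (b' + 1) n).det - (hankel b' n).det) •
          !![0, c₁, c₀; c₀, 0, c₁; c₁, c₀, 0]).det := by
  rw [hankel_add_one, ← det_one_kronecker_add_kronecker_one]
  rw [← det_of_add_eq_det_hankel (ι := Fin 3 × Fin n) b
    (f := fun p => 3 * p.2 + p.1) (g := fun p => 3 * p.2 + (2 - p.1))]
  · congr 1
    ext ⟨r, i⟩ ⟨s, j⟩
    fin_cases r <;> fin_cases s <;> simp [hankel]
    · exact (congrArg b (by ring)).trans (h2 (i + j))
    · exact (congrArg b (by ring)).trans (h1 (i + j))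
    · exact (congrArg b (by ring)).trans (h0 (i + j))
    · exact (congrArg b (by ring)).trans (h0 (i + j + 1))
    · exact (congrArg b (by ring)).trans (h2 (i + j))
    · exact (congrArg b (by ring)).trans (h1 (i + j))
    · exact (congrArg b (by ring)).trans (h1 (i + j + 1))
    · exact (congrArg b (by ring)).trans (h0 (i + j + 1))
    · exact (congrArg b (by ring)).trans (h2 (i + j))
  · rintro ⟨r, i⟩ ⟨s, j⟩ h
    simp only at h
    ext <;> simp only <;> omega
  · rintro ⟨r, i⟩
    simp only
    omega
  · rintro ⟨r, i⟩ ⟨s, j⟩ h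
    simp only at h
    ext <;> simp only <;> omega
  · rintro ⟨r, i⟩
    simp only
    omega
  · simp

theorem det_hankel_of_eq_two_mul_add {a : ℕ → ZMod 2}
    (h0 : ∀ t, a (3 * t) = 1) (h1 : ∀ t, a (3 * t + 1) = 0) (h2 : ∀ t, a (3 * t + 2) = a t + 1)
    {n m N : ℕ} (hnm : n ≤ m) (hmn : m ≤ n + 1)
    (hN : N = 2 * n + m + 1) :
    (hankel a N).det = (hankelLastOne a n).det * (hankel (a + 1) m).det := by
  subst hN
  rw [det_hankel_of_trisection (b' := a + 1) h0 h1 h2 hnm hmn, det_fromBlocks_one_zero,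
    det_hankelLastOne_add_one]

theorem det_hankel_add_one_of_eq_two_mul_add {a : ℕ → ZMod 2}
    (h0 : ∀ t, a (3 * t) = 1) (h1 : ∀ t, a (3 * t + 1) = 0) (h2 : ∀ t, a (3 * t + 2) = a t + 1)
    {n m N : ℕ} (hnm : n ≤ m) (hmn : m ≤ n + 1)
    (hN : N = 2 * n + m + 1) :
    (hankel (a + 1) N).det =
    (hankelLastOne a n).det * ((hankel a m).det + (hankel (a + 1) m).det) := by
  subst hN
  rw [det_hankel_of_trisection (b := a + 1) (b' := a) (c₀ := 0) (c₁ := 1) _ _ _ hnm hmn,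
    det_fromBlocks_zero_one]
  · intro t; simp [h0, CharTwo.add_self_eq_zero]
  · intro t; simp [h1]
  · intro t; simp [h2, add_assoc, CharTwo.add_self_eq_zero]

theorem det_hankel_three_mul {a : ℕ → ZMod 2}
    (h0 : ∀ t, a (3 * t) = 1) (h1 : ∀ t, a (3 * t + 1) = 0) (h2 : ∀ t, a (3 * t + 2) = a t + 1)
    (n : ℕ) : (hankel a (3 * n)).det = (hankel a n).det := by
  rw [det_hankel_three_mul_of_trisection (b' := a + 1) h0 h1 h2, add_one_add_one]
  generalize (hankel a n).det = x
  generalize (hankel (a + 1) n).det = y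
  revert x y
  simp only [det_fin_three]
  decide

theorem det_hankel_add_one_three_mul {a : ℕ → ZMod 2}
    (h0 : ∀ t, a (3 * t) = 1) (h1 : ∀ t, a (3 * t + 1) = 0) (h2 : ∀ t, a (3 * t + 2) = a t + 1)
    (n : ℕ) :
    (hankel (a + 1) (3 * n)).det = (hankel (a + 1) n).det := by
  rw [det_hankel_three_mul_of_trisection (b := a + 1) (b' := a) (c₀ := 0) (c₁ := 1)]
  · generalize (hankel a n).det = x
    generalize (hankel (a + 1) n).det = y
    revert x y
    simp only [det_fin_three]
    decide
  · intro t; simp [h0, CharTwo.add_self_eq_zero]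
  · intro t; simp [h1]
  · intro t; simp [h2, add_assoc, CharTwo.add_self_eq_zero]

theorem natCast_permCount (S : Set ℕ) (m l : ℕ) :
    (permCount S m l : ZMod 2) =
      (of fun i j : Fin m => if (i : ℕ) = l then 1 else S.indicator 1 ((i : ℕ) + j)).det := by
  classical
  rw [← det_transpose, det_apply', permCount, Nat.card_eq_fintype_card, Fintype.card_subtype,
    Finset.card_filter, Nat.cast_sum]
  refine Finset.sum_congr rfl fun σ _ => ?_
  rw [ZMod.intCast_units_two, one_mul, Nat.cast_ite, Nat.cast_one, Nat.cast_zero]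
  have h (i : Fin m) : (of fun i j : Fin m => if (i : ℕ) = l then (1 : ZMod 2) else
      S.indicator 1 ((i : ℕ) + j))ᵀ (σ i) i =
      if (i : ℕ) ≠ l → (i : ℕ) + (σ i : Fin m) ∈ S then 1 else 0 := by
    by_cases hi : (i : ℕ) = l <;> simp [hi, Set.indicator_apply]
  simp_rw [h, Finset.prod_boole, Finset.mem_univ, true_imp_iff]

theorem natCast_permCount_self (S : Set ℕ) (m : ℕ) :
    (permCount S m m : ZMod 2) = (hankel (S.indicator 1) m).det := by
  rw [natCast_permCount]
  congr 1
  ext i j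
  simp [hankel, i.2.ne]

theorem natCast_permCount_last (S : Set ℕ) (n : ℕ) :
    (permCount S (n + 1) n : ZMod 2) = (hankelLastOne (S.indicator 1) n).det := by
  rw [natCast_permCount]
  congr 1
  ext i j
  simp [hankelLastOne, hankel, updateRow_apply, Fin.ext_iff]

theorem natCast_sum_permCount (S : Set ℕ) (m : ℕ) :
    ((∑ i ∈ Finset.range m, permCount S m i : ℕ) : ZMod 2) =
      (hankel (S.indicator 1) m).det + (hankel (S.indicator 1 + 1) m).det := by
  rw [hankel_add_one, det_add_one_eq_add_sum, ← add_assoc, CharTwo.add_self_eq_zero, zero_add,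
    Nat.cast_sum, Finset.sum_range]
  refine Finset.sum_congr rfl fun l _ => ?_
  rw [natCast_permCount]
  congr 1
  ext i j
  simp [hankel, updateRow_apply, Fin.ext_iff]

theorem three_mul_mem_J3 (t : ℕ) : 3 * t ∈ J3 := .inl ⟨t, 0, by ring⟩

theorem three_mul_add_one_mem_K3 (t : ℕ) : 3 * t + 1 ∈ K3 := .inl ⟨t, 0, by ring⟩

theorem three_mul_notMem_K3 (t : ℕ) : 3 * t ∉ K3 := by
  rintro (⟨n, k, h⟩ | ⟨n, k, h⟩)
  · rcases k with _ | k
    · simp at h; omega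
    · rw [show 2 * (k + 1) = 2 * k + 1 + 1 by ring, pow_succ, ← mul_assoc] at h
      omega
  · rw [pow_succ, ← mul_assoc] at h
    omega

theorem three_mul_add_one_notMem_J3 (t : ℕ) : 3 * t + 1 ∉ J3 := by
  rintro (⟨n, k, h⟩ | ⟨n, k, h⟩)
  · rcases k with _ | k
    · simp at h; omega
    · rw [show 2 * (k + 1) = 2 * k + 1 + 1 by ring, pow_succ, ← mul_assoc] at h
      omega
  · rw [pow_succ, ← mul_assoc] at h
    omega

theorem three_mul_add_two_mem_J3_iff (t : ℕ) : 3 * t + 2 ∈ J3 ↔ t ∈ K3 := by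
  constructor
  · rintro (⟨n, k, h⟩ | ⟨n, k, h⟩)
    · rcases k with _ | k
      · simp at h; omega
      · rw [show 2 * (k + 1) = 2 * k + 1 + 1 by ring, pow_succ, ← mul_assoc] at h
        exact .inr ⟨n, k, by omega⟩
    · rw [pow_succ, ← mul_assoc] at h
      exact .inl ⟨n, k, by omega⟩
  · rintro (⟨n, k, h⟩ | ⟨n, k, h⟩)
    · exact .inr ⟨n, k, by rw [pow_succ, ← mul_assoc]; omega⟩
    · refine .inl ⟨n, k + 1, ?_⟩
      rw [show 2 * (k + 1) = 2 * k + 1 + 1 by ring, pow_succ, ← mul_assoc]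
      omega

theorem three_mul_add_two_mem_K3_iff (t : ℕ) : 3 * t + 2 ∈ K3 ↔ t ∈ J3 := by
  constructor
  · rintro (⟨n, k, h⟩ | ⟨n, k, h⟩)
    · rcases k with _ | k
      · simp at h; omega
      · rw [show 2 * (k + 1) = 2 * k + 1 + 1 by ring, pow_succ, ← mul_assoc] at h
        exact .inr ⟨n, k, by omega⟩
    · rw [pow_succ, ← mul_assoc] at h
      exact .inl ⟨n, k, by omega⟩
  · rintro (⟨n, k, h⟩ | ⟨n, k, h⟩)
    · exact .inr ⟨n, k, by rw [pow_succ, ← mul_assoc]; omega⟩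
    · refine .inl ⟨n, k + 1, ?_⟩
      rw [show 2 * (k + 1) = 2 * k + 1 + 1 by ring, pow_succ, ← mul_assoc]
      omega

theorem K3_eq_compl_J3 : K3 = J3ᶜ := by
  ext t
  rw [Set.mem_compl_iff]
  induction t using Nat.strong_induction_on with
  | _ t ih =>
    obtain ⟨s, rfl | rfl | rfl⟩ : ∃ s, t = 3 * s ∨ t = 3 * s + 1 ∨ t = 3 * s + 2 :=
      ⟨t / 3, by omega⟩
    · simp [three_mul_mem_J3, three_mul_notMem_K3]
    · simp [three_mul_add_one_mem_K3, three_mul_add_one_notMem_J3]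
    · rw [three_mul_add_two_mem_J3_iff, three_mul_add_two_mem_K3_iff, ih s (by omega), not_not]

theorem indicator_K3 : K3.indicator (1 : ℕ → ZMod 2) = J3.indicator 1 + 1 := by
  classical
  ext t
  by_cases h : t ∈ J3 <;> simp [K3_eq_compl_J3, h, CharTwo.add_self_eq_zero]

theorem natCast_Z (n : ℕ) : (Z (n + 1) : ZMod 2) = (hankelLastOne (J3.indicator 1) n).det :=
  natCast_permCount_last J3 n

theorem natCast_W (n : ℕ) : (W (n + 1) : ZMod 2) = (hankelLastOne (J3.indicator 1) n).det := by
  rw [← det_hankelLastOne_add_one, ← indicator_K3]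
  exact natCast_permCount_last K3 n

theorem natCast_T (n : ℕ) : (T n : ZMod 2) = (hankel (J3.indicator 1) n).det +
    (hankel (J3.indicator 1 + 1) n).det +
      (hankel (J3.indicator 1) n).det * (hankel (J3.indicator 1 + 1) n).det := by
  simp only [T, X, Y, Nat.cast_add, Nat.cast_mul, natCast_sum_permCount, natCast_permCount_self]
  generalize (hankel (J3.indicator 1) n).det = x
  generalize (hankel (J3.indicator 1 + 1) n).det = y
  revert x y
  decide

theorem natCast_R (n : ℕ) : (R n : ZMod 2) = T n := by
  rw [natCast_T]
  simp only [R, U, V, Nat.cast_add, Nat.cast_mul, natCast_sum_permCount, natCast_permCount_self,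
    indicator_K3, add_one_add_one]
  generalize (hankel (J3.indicator 1) n).det = x
  generalize (hankel (J3.indicator 1 + 1) n).det = y
  revert x y
  decide

/-- Simplified recurrences mod 2 for `Z, W, T, R` (case `d = 3`). -/
theorem F3_recurrences_ZWTR :
    ∀ n : ℕ, 1 ≤ n →
      Z (3 * n) ≡ W n * R n [MOD 2] ∧
      W (3 * n) ≡ Z n * T n [MOD 2] ∧
      Z (3 * n + 1) ≡ W (n + 1) * R n [MOD 2] ∧
      W (3 * n + 1) ≡ Z (n + 1) * T n [MOD 2] ∧
      Z (3 * n + 2) ≡ W (n + 1) [MOD 2] ∧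
      W (3 * n + 2) ≡ Z (n + 1) [MOD 2] ∧
      T (3 * n) ≡ R n [MOD 2] ∧
      R (3 * n) ≡ T n [MOD 2] ∧
      T (3 * n + 1) ≡ W (n + 1) * R n [MOD 2] ∧
      R (3 * n + 1) ≡ Z (n + 1) * T n [MOD 2] ∧
      T (3 * n + 2) ≡ W (n + 1) * R (n + 1) [MOD 2] ∧
      R (3 * n + 2) ≡ Z (n + 1) * T (n + 1) [MOD 2] := by
  intro n hn
  obtain ⟨k, rfl⟩ := Nat.exists_eq_add_of_le' hn
  have h0 (t : ℕ) : J3.indicator (1 : ℕ → ZMod 2) (3 * t) = 1 := by simp [three_mul_mem_J3]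
  have h1 (t : ℕ) : J3.indicator (1 : ℕ → ZMod 2) (3 * t + 1) = 0 := by
    simp [three_mul_add_one_notMem_J3]
  have h2 (t : ℕ) : J3.indicator (1 : ℕ → ZMod 2) (3 * t + 2) = J3.indicator 1 t + 1 := by
    rw [← Pi.one_apply (M := fun _ : ℕ => ZMod 2) t, ← Pi.add_apply, ← indicator_K3]
    classical
    simp only [Set.indicator_apply, three_mul_add_two_mem_J3_iff, Pi.one_apply]
  have hD0 := det_hankel_three_mul h0 h1 h2
  have hF0 := det_hankel_add_one_three_mul h0 h1 h2
  have hD1 (n : ℕ) := det_hankel_of_eq_two_mul_add h0 h1 h2 le_rfl n.le_succ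
    (show 3 * n + 1 = _ by ring)
  have hF1 (n : ℕ) := det_hankel_add_one_of_eq_two_mul_add h0 h1 h2 le_rfl n.le_succ
    (show 3 * n + 1 = _ by ring)
  have hD2 (n : ℕ) := det_hankel_of_eq_two_mul_add h0 h1 h2 (Nat.le_add_right n 1) le_rfl
    (show 3 * n + 2 = _ by ring)
  have hF2 (n : ℕ) := det_hankel_add_one_of_eq_two_mul_add h0 h1 h2 (Nat.le_add_right n 1) le_rfl
    (show 3 * n + 2 = _ by ring)
  have hZ := det_hankelLastOne_eq_cross (J3.indicator 1)
  have e3 : 3 * (k + 1) = 3 * k + 2 + 1 := by ring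
  have e4 : 3 * (k + 1) + 2 = 3 * (k + 1) + 1 + 1 := by ring
  have hz := hZ (k + 1)
  have hz1 := hZ (3 * (k + 1))
  have z0 := (natCast_Z _).trans (hZ (3 * k + 2))
  have w0 := (natCast_W _).trans (hZ (3 * k + 2))
  have z2 := (natCast_Z _).trans (hZ (3 * (k + 1) + 1))
  have w2 := (natCast_W _).trans (hZ (3 * (k + 1) + 1))
  rw [← e3] at z0 w0
  rw [← e4] at z2 w2
  simp only [← ZMod.natCast_eq_natCast_iff, Nat.cast_mul, natCast_R, z0, w0, z2, w2, natCast_Z,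
    natCast_W, natCast_T, hz1, hD0, hF0, hD1, hF1, hD2, hF2]
  generalize (hankelLastOne (J3.indicator 1) k).det = y
  generalize (hankelLastOne (J3.indicator 1) (k + 1)).det = z at hz ⊢
  generalize (hankel (J3.indicator 1) (k + 1)).det = d at hz ⊢
  generalize (hankel (J3.indicator 1 + 1) (k + 1)).det = f at hz ⊢
  generalize (hankel (J3.indicator 1) (k + 1 + 1)).det = d' at hz ⊢
  generalize (hankel (J3.indicator 1 + 1) (k + 1 + 1)).det = f' at hz ⊢
  clear * - hz
  refine ⟨?_, ?_, ?_, ?_, ?_, ?_, ?_, ?_, ?_, ?_, ?_, ?_⟩ <;>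
  · revert y z d f d' f'
    decide
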